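/- Let x₀ > 0 and θ > 0 with M_{x₀} < 2. Then the function u := S^> · v^< is twice continuously differentiable on (x₀, ∞), satisfies u''(x) + c(x)^(−2) u(x) = 0 on [x₀, ∞), and (u(x₀), u'(x₀)) ≠ (0, 0). Moreover u(x₀) = b(x₀)(e^(−iφ(x₀)) + R_{x₀} e^(iφ(x₀))) and u'(x₀) = (b'(x₀)/b(x₀)) u(x₀) + i φ'(x₀) b(x₀) (R_{x₀} e^(iφ(x₀)) − e^(−iφ(x₀))), where φ'(x₀) = c(x₀)^(−1). -/

import Mathlib

open MeasureTheory Set Filter Topology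

noncomputable section

/-- The wave speed profile `c(x) = (1 + θ (x₊)^α)^(-1/2)`. -/
def spd (α θ x : ℝ) : ℝ := (1 + θ * (max x 0) ^ α) ^ (-(1 / 2) : ℝ)

/-- The WKB amplitude `b(x) = c(x)^(1/2)`. -/
def amp (α θ x : ℝ) : ℝ := spd α θ x ^ ((1 : ℝ) / 2)

/-- The WKB phase `φ(x) = ∫₀ˣ c(y)⁻¹ dy`. -/
def phase (α θ x : ℝ) : ℝ := ∫ y in (0:ℝ)..x, (spd α θ y)⁻¹

/-- `M(x) = c(x)^(1/2) (c^(1/2))''(x)` for `x > 0`, and `0` for `x ≤ 0`. -/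
def Mfun (α θ x : ℝ) : ℝ :=
  if 0 < x then
    spd α θ x ^ ((1 : ℝ) / 2) * deriv (deriv (fun y => spd α θ y ^ ((1 : ℝ) / 2))) x
  else 0

/-- `M_{x₀} = ∫_{x₀}^∞ |M(x)| dx`. -/
def Mtail (α θ x₀ : ℝ) : ℝ := ∫ x in Ioi x₀, |Mfun α θ x|

/-- The Volterra operator `K_σ`. -/
def Kop (α θ x₀ σ : ℝ) (f : ℝ → ℂ) (x : ℝ) : ℂ :=
  (2 * Complex.I * (1 + Complex.I * (σ : ℂ)))⁻¹ *
    ((∫ y in x₀..x, (Mfun α θ y : ℂ) * f y *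
        Complex.exp (-2 * Complex.I * (1 + Complex.I * (σ : ℂ)) *
          ((phase α θ x - phase α θ y : ℝ) : ℂ))) +
      ∫ y in Ioi x, (Mfun α θ y : ℂ) * f y)

/-- The right-going WKB wave `v^> = b e^{-iφ}`. -/
def vplus (α θ x : ℝ) : ℂ := (amp α θ x : ℂ) * Complex.exp (-Complex.I * (phase α θ x : ℂ))

/-- The left-going WKB wave `v^< = b e^{iφ}`. -/
def vminus (α θ x : ℝ) : ℂ := (amp α θ x : ℂ) * Complex.exp (Complex.I * (phase α θ x : ℂ))

/-- `S` is a bounded continuous solution on `[x₀,∞)` of `S = e^{-2iφ} + K₀ S`. -/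
def IsVolterraSol (α θ x₀ : ℝ) (S : ℝ → ℂ) : Prop :=
  (∃ C, ∀ x ∈ Ici x₀, ‖S x‖ ≤ C) ∧ ContinuousOn S (Ici x₀) ∧
    ∀ x ∈ Ici x₀, S x = Complex.exp (-2 * Complex.I * (phase α θ x : ℂ)) + Kop α θ x₀ 0 S x

/-- `R_{x₀} = (2i)⁻¹ ∫_{x₀}^∞ M S^>`. -/
def Rx (α θ x₀ : ℝ) (S : ℝ → ℂ) : ℂ :=
  (2 * Complex.I)⁻¹ * ∫ x in Ioi x₀, (Mfun α θ x : ℂ) * S x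

/-- The base `1 + θ (x₊)^α` of the wave speed is at least `1`. -/
lemma one_le_spd_base {θ : ℝ} (α : ℝ) (hθ : 0 < θ) (x : ℝ) : 1 ≤ 1 + θ * (max x 0) ^ α := by
  have := Real.rpow_nonneg (le_max_right x 0) α
  nlinarith

lemma spd_pos {θ : ℝ} (α : ℝ) (hθ : 0 < θ) (x : ℝ) : 0 < spd α θ x :=
  Real.rpow_pos_of_pos (by linarith [one_le_spd_base α hθ x]) _

lemma spd_le_one {θ : ℝ} (α : ℝ) (hθ : 0 < θ) (x : ℝ) : spd α θ x ≤ 1 :=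
  Real.rpow_le_one_of_one_le_of_nonpos (one_le_spd_base α hθ x) (by norm_num)

lemma continuous_spd {α θ : ℝ} (hα : 0 < α) (hθ : 0 < θ) : Continuous (spd α θ) := by
  unfold spd
  refine Continuous.rpow_const ?_ fun x => Or.inl (by linarith [one_le_spd_base α hθ x])
  exact continuous_const.add (continuous_const.mul
    ((continuous_id.max continuous_const).rpow_const fun x => Or.inr hα.le))

lemma amp_pos {θ : ℝ} (α : ℝ) (hθ : 0 < θ) (x : ℝ) : 0 < amp α θ x :=
  Real.rpow_pos_of_pos (spd_pos α hθ x) _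

lemma amp_mul_self {θ : ℝ} (α : ℝ) (hθ : 0 < θ) (x : ℝ) :
    amp α θ x * amp α θ x = spd α θ x := by
  unfold amp
  rw [← Real.rpow_add (spd_pos α hθ x)]
  norm_num

lemma continuous_amp {α θ : ℝ} (hα : 0 < α) (hθ : 0 < θ) : Continuous (amp α θ) :=
  (continuous_spd hα hθ).rpow_const fun x => Or.inl (spd_pos α hθ x).ne'

lemma hasDerivAt_phase {α θ : ℝ} (hα : 0 < α) (hθ : 0 < θ) (x : ℝ) :
    HasDerivAt (phase α θ) (spd α θ x)⁻¹ x :=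
  ((continuous_spd hα hθ).inv₀ fun y => (spd_pos α hθ y).ne').integral_hasStrictDerivAt 0 x
    |>.hasDerivAt

/-- The logarithmic derivative of `c` is `-(α / 2) (1 - c²) / x`. -/
lemma hasDerivAt_spd {θ x : ℝ} (α : ℝ) (hθ : 0 < θ) (hx : 0 < x) :
    HasDerivAt (spd α θ) (-(α / 2) * spd α θ x * (1 - spd α θ x ^ 2) / x) x := by
  have hg : 0 < 1 + θ * x ^ α := by
    have := Real.rpow_nonneg hx.le α
    nlinarith
  have h : HasDerivAt (fun y : ℝ => (1 + θ * y ^ α) ^ (-(1 / 2) : ℝ))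
      (θ * (α * x ^ (α - 1)) * (-(1 / 2)) * (1 + θ * x ^ α) ^ (-(1 / 2) - 1 : ℝ)) x :=
    (((Real.hasDerivAt_rpow_const (Or.inl hx.ne')).const_mul θ).const_add 1).rpow_const
      (Or.inl hg.ne')
  have he : spd α θ =ᶠ[𝓝 x] fun y : ℝ => (1 + θ * y ^ α) ^ (-(1 / 2) : ℝ) := by
    filter_upwards [Ioi_mem_nhds hx] with y hy
    simp only [spd, max_eq_left (mem_Ioi.1 hy).le]
  refine (h.congr_of_eventuallyEq he).congr_deriv ?_
  have hsq : (((1 + θ * x ^ α) ^ (-(1 / 2) : ℝ)) ^ 2 : ℝ) = (1 + θ * x ^ α)⁻¹ := by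
    rw [← Real.rpow_natCast, ← Real.rpow_mul hg.le, ← Real.rpow_neg_one]
    norm_num
  rw [he.eq_of_nhds, hsq, Real.rpow_sub_one hg.ne', Real.rpow_sub_one hx.ne']
  field_simp
  ring

/-- The first derivative of the amplitude on `(0, ∞)`. -/
def ampDeriv (α θ x : ℝ) : ℝ := -(α / 4) * amp α θ x * (1 - spd α θ x ^ 2) / x

/-- The second derivative of the amplitude on `(0, ∞)`. -/
def ampDeriv₂ (α θ x : ℝ) : ℝ :=
  -(α / 4) * amp α θ x * (1 - spd α θ x ^ 2) *
    (-(α / 4) * (1 - spd α θ x ^ 2) + α * spd α θ x ^ 2 - 1) / x ^ 2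

lemma hasDerivAt_amp {θ x : ℝ} (α : ℝ) (hθ : 0 < θ) (hx : 0 < x) :
    HasDerivAt (amp α θ) (ampDeriv α θ x) x := by
  have hs := spd_pos α hθ x
  refine ((hasDerivAt_spd α hθ hx).rpow_const (p := 1 / 2) (Or.inl hs.ne')).congr_deriv ?_
  rw [Real.rpow_sub_one hs.ne']
  simp only [ampDeriv, amp]
  field_simp
  ring

lemma hasDerivAt_ampDeriv {θ x : ℝ} (α : ℝ) (hθ : 0 < θ) (hx : 0 < x) :
    HasDerivAt (ampDeriv α θ) (ampDeriv₂ α θ x) x := by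
  refine ((((hasDerivAt_amp α hθ hx).const_mul (-(α / 4))).mul
    (((hasDerivAt_spd α hθ hx).pow 2).const_sub 1)).div (hasDerivAt_id x) hx.ne').congr_deriv ?_
  simp only [ampDeriv, ampDeriv₂, id, Pi.mul_apply, Pi.pow_apply]
  field_simp
  push_cast
  ring

lemma Mfun_eq {θ x : ℝ} (α : ℝ) (hθ : 0 < θ) (hx : 0 < x) :
    Mfun α θ x = amp α θ x * ampDeriv₂ α θ x := by
  have h : deriv (amp α θ) =ᶠ[𝓝 x] ampDeriv α θ := by
    filter_upwards [Ioi_mem_nhds hx] with y hy using (hasDerivAt_amp α hθ hy).deriv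
  have h₂ : deriv (deriv (amp α θ)) x = ampDeriv₂ α θ x :=
    h.deriv_eq.trans (hasDerivAt_ampDeriv α hθ hx).deriv
  rw [← h₂]
  exact if_pos hx

lemma continuousOn_Mfun {α θ : ℝ} (hα : 0 < α) (hθ : 0 < θ) :
    ContinuousOn (Mfun α θ) (Ioi 0) := by
  refine ContinuousOn.congr (f := fun x => amp α θ x * ampDeriv₂ α θ x) ?_
    fun x hx => Mfun_eq α hθ hx
  have hs := continuous_spd hα hθ
  have ha := continuous_amp hα hθ
  unfold ampDeriv₂
  refine ha.continuousOn.mul (ContinuousOn.div (by fun_prop) (by fun_prop) fun x hx => ?_)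
  exact pow_ne_zero 2 (ne_of_gt hx)

lemma abs_Mfun_le {α θ x : ℝ} (hα : 0 < α) (hθ : 0 < θ) (hx : 0 < x) :
    |Mfun α θ x| ≤ α / 4 * (α / 4 + α + 1) * x ^ (-2 : ℝ) := by
  have hs := spd_pos α hθ x
  have hq : spd α θ x ^ 2 ≤ 1 := pow_le_one₀ hs.le (spd_le_one α hθ x)
  have hq₀ : 0 ≤ spd α θ x ^ 2 := sq_nonneg _
  have he : Mfun α θ x = -(α / 4) * (spd α θ x * (1 - spd α θ x ^ 2)) *
      (-(α / 4) * (1 - spd α θ x ^ 2) + α * spd α θ x ^ 2 - 1) * (x ^ 2)⁻¹ := by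
    rw [Mfun_eq α hθ hx, ← amp_mul_self α hθ x, ampDeriv₂, ← amp_mul_self α hθ x]
    ring
  have h₁ : |spd α θ x * (1 - spd α θ x ^ 2)| ≤ 1 := by
    rw [abs_of_nonneg (mul_nonneg hs.le (by linarith))]
    exact mul_le_one₀ (spd_le_one α hθ x) (by linarith) (by linarith)
  have h₂ : |-(α / 4) * (1 - spd α θ x ^ 2) + α * spd α θ x ^ 2 - 1| ≤ α / 4 + α + 1 := by
    rw [abs_le]
    constructor <;> nlinarith
  rw [he, abs_mul, abs_mul, abs_mul, abs_neg, abs_of_pos (by positivity : 0 < α / 4),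
    abs_of_pos (by positivity : 0 < (x ^ 2)⁻¹), Real.rpow_neg hx.le, Real.rpow_two]
  gcongr
  calc α / 4 * |spd α θ x * (1 - spd α θ x ^ 2)| ≤ α / 4 * 1 := by gcongr
    _ = α / 4 := mul_one _

lemma integrableOn_Mfun {α θ x₀ : ℝ} (hα : 0 < α) (hθ : 0 < θ) (hx₀ : 0 < x₀) :
    IntegrableOn (Mfun α θ) (Ioi x₀) := by
  refine Integrable.mono' (((integrableOn_Ioi_rpow_of_lt (by norm_num : (-2 : ℝ) < -1)
    hx₀).const_mul (α / 4 * (α / 4 + α + 1))))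
    (((continuousOn_Mfun hα hθ).mono (Ioi_subset_Ioi hx₀.le)).aestronglyMeasurable
      measurableSet_Ioi) ?_
  filter_upwards [ae_restrict_mem measurableSet_Ioi] with x hx
  exact abs_Mfun_le hα hθ (hx₀.trans hx)

lemma integrableOn_Mfun_mul {α θ x₀ : ℝ} (hα : 0 < α) (hθ : 0 < θ) (hx₀ : 0 < x₀) {S : ℝ → ℂ}
    (hb : ∃ C, ∀ x ∈ Ici x₀, ‖S x‖ ≤ C) (hc : ContinuousOn S (Ici x₀)) :
    IntegrableOn (fun x => (Mfun α θ x : ℂ) * S x) (Ioi x₀) := by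
  obtain ⟨C, hC⟩ := hb
  refine (integrableOn_Mfun hα hθ hx₀).ofReal.mul_bdd (c := C)
    ((hc.mono Ioi_subset_Ici_self).aestronglyMeasurable measurableSet_Ioi) ?_
  filter_upwards [ae_restrict_mem measurableSet_Ioi] with x hx
  exact hC x (mem_Ioi.1 hx).le

/-- Variation of parameters: if the coefficients of the two WKB waves have derivatives `P'`, `Q'`
with `e^{-iφ} P' + e^{iφ} Q' = 0`, then the derivative of their combination only involves the
derivatives of the waves. -/
lemma hasDerivAt_wkb_comb {α θ x : ℝ} (hα : 0 < α) (hθ : 0 < θ) (hx : 0 < x) {P Q : ℝ → ℂ}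
    {P' Q' : ℂ} (hP : HasDerivAt P P' x) (hQ : HasDerivAt Q Q' x)
    (h : Complex.exp (-Complex.I * phase α θ x) * P' + Complex.exp (Complex.I * phase α θ x) * Q'
      = 0) :
    HasDerivAt (fun y => (amp α θ y : ℂ) * (Complex.exp (-Complex.I * phase α θ y) * P y +
        Complex.exp (Complex.I * phase α θ y) * Q y))
      (ampDeriv α θ x * (Complex.exp (-Complex.I * phase α θ x) * P x +
        Complex.exp (Complex.I * phase α θ x) * Q x) +
      Complex.I * (amp α θ x : ℂ)⁻¹ * (Complex.exp (Complex.I * phase α θ x) * Q x -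
        Complex.exp (-Complex.I * phase α θ x) * P x)) x := by
  have hφ := (hasDerivAt_phase hα hθ x).ofReal_comp
  have ha : (amp α θ x : ℂ) ≠ 0 := Complex.ofReal_ne_zero.2 (amp_pos α hθ x).ne'
  refine ((hasDerivAt_amp α hθ hx).ofReal_comp.mul
    (((hφ.const_mul (-Complex.I)).cexp.mul hP).add
      ((hφ.const_mul Complex.I).cexp.mul hQ))).congr_deriv ?_
  rw [← amp_mul_self α hθ x]
  simp only [Pi.add_apply, Pi.mul_apply]
  push_cast
  generalize Complex.exp (-Complex.I * phase α θ x) = E at *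
  generalize Complex.exp (Complex.I * phase α θ x) = F at *
  field_simp
  linear_combination (amp α θ x : ℂ) ^ 2 * h

/-- Under the second variation of parameters relation, the derivative of the WKB combination is
differentiable and the combination solves `u'' + c⁻² u = 0`. -/
lemma hasDerivAt_wkb_comb_deriv {α θ x : ℝ} (hα : 0 < α) (hθ : 0 < θ) (hx : 0 < x) {P Q : ℝ → ℂ}
    {P' Q' : ℂ} (hP : HasDerivAt P P' x) (hQ : HasDerivAt Q Q' x)
    (h : Complex.exp (-Complex.I * phase α θ x) * P' + Complex.exp (Complex.I * phase α θ x) * Q'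
      = 0)
    (h₂ : Complex.exp (Complex.I * phase α θ x) * Q' - Complex.exp (-Complex.I * phase α θ x) * P'
      = Complex.I * Mfun α θ x * (Complex.exp (-Complex.I * phase α θ x) * P x +
        Complex.exp (Complex.I * phase α θ x) * Q x)) :
    HasDerivAt (fun y => (ampDeriv α θ y : ℂ) * (Complex.exp (-Complex.I * phase α θ y) * P y +
        Complex.exp (Complex.I * phase α θ y) * Q y) +
      Complex.I * (amp α θ y : ℂ)⁻¹ * (Complex.exp (Complex.I * phase α θ y) * Q y -
        Complex.exp (-Complex.I * phase α θ y) * P y))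
      (-((spd α θ x : ℂ)⁻¹ ^ 2 * ((amp α θ x : ℂ) * (Complex.exp (-Complex.I * phase α θ x) * P x +
        Complex.exp (Complex.I * phase α θ x) * Q x)))) x := by
  have hφ := (hasDerivAt_phase hα hθ x).ofReal_comp
  have ha : (amp α θ x : ℂ) ≠ 0 := Complex.ofReal_ne_zero.2 (amp_pos α hθ x).ne'
  have hp := (hφ.const_mul (-Complex.I)).cexp.mul hP
  have hq := (hφ.const_mul Complex.I).cexp.mul hQ
  refine (((hasDerivAt_ampDeriv α hθ hx).ofReal_comp.mul (hp.add hq)).add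
    ((((hasDerivAt_amp α hθ hx).ofReal_comp.inv ha).const_mul Complex.I).mul
      (hq.sub hp))).congr_deriv ?_
  rw [Mfun_eq α hθ hx] at h₂
  rw [← amp_mul_self α hθ x]
  simp only [Pi.add_apply, Pi.mul_apply, Pi.sub_apply, Pi.inv_apply]
  push_cast at h₂ ⊢
  generalize Complex.exp (-Complex.I * phase α θ x) = E at *
  generalize Complex.exp (Complex.I * phase α θ x) = F at *
  generalize (amp α θ x : ℂ) = a at *
  generalize (ampDeriv α θ x : ℂ) = a' at *
  generalize (ampDeriv₂ α θ x : ℂ) = a'' at *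
  field_simp
  linear_combination a ^ 3 * a' * h + a ^ 2 * Complex.I * h₂ + 
    (E * P x + F * Q x) * (a ^ 3 * a'' + 1) * Complex.I_sq

/-- On `[x₀, ∞)` the operator `K₀` splits into primitives of continuous functions. -/
lemma Kop_zero_eq {α θ x₀ x : ℝ} {S : ℝ → ℂ}
    (hint : IntegrableOn (fun y => (Mfun α θ y : ℂ) * S y) (Ioi x₀)) (hx : x₀ ≤ x) :
    Kop α θ x₀ 0 S x = (2 * Complex.I)⁻¹ *
      (Complex.exp (-2 * Complex.I * phase α θ x) *
        (∫ y in x₀..x, (Mfun α θ (max y x₀) : ℂ) * S (max y x₀) *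
          Complex.exp (2 * Complex.I * phase α θ y)) +
      ((∫ y in Ioi x₀, (Mfun α θ y : ℂ) * S y) -
        ∫ y in x₀..x, (Mfun α θ (max y x₀) : ℂ) * S (max y x₀))) := by
  have hmax : ∀ y ∈ uIcc x₀ x, max y x₀ = y := fun y hy => by
    rw [uIcc_of_le hx] at hy
    exact max_eq_left hy.1
  have h₁ : ∫ y in x₀..x, (Mfun α θ (max y x₀) : ℂ) * S (max y x₀) =
      ∫ y in x₀..x, (Mfun α θ y : ℂ) * S y :=
    intervalIntegral.integral_congr fun y hy => by simp only [hmax y hy]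
  have h₂ : (∫ y in Ioi x₀, (Mfun α θ y : ℂ) * S y) - ∫ y in x₀..x, (Mfun α θ y : ℂ) * S y =
      ∫ y in Ioi x, (Mfun α θ y : ℂ) * S y := by
    rw [← intervalIntegral.integral_Ioi_sub_Ioi hint hx, sub_sub_cancel]
  rw [h₁, h₂, Kop, ← intervalIntegral.integral_const_mul]
  simp only [Complex.ofReal_zero, mul_zero, add_zero, mul_one]
  congr 2
  refine intervalIntegral.integral_congr fun y hy => ?_
  simp only [hmax y hy]
  rw [mul_left_comm, ← Complex.exp_add]
  push_cast
  ring_nf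

/-- The coefficient of `v^>` in `u = S^> v^<`. -/
def coeffPlus (α θ x₀ : ℝ) (S : ℝ → ℂ) (x : ℝ) : ℂ :=
  1 + (2 * Complex.I)⁻¹ * ∫ y in x₀..x, (Mfun α θ (max y x₀) : ℂ) * S (max y x₀) *
    Complex.exp (2 * Complex.I * phase α θ y)

/-- The coefficient of `v^<` in `u = S^> v^<`. -/
def coeffMinus (α θ x₀ : ℝ) (S : ℝ → ℂ) (x : ℝ) : ℂ :=
  (2 * Complex.I)⁻¹ * ((∫ y in Ioi x₀, (Mfun α θ y : ℂ) * S y) -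
    ∫ y in x₀..x, (Mfun α θ (max y x₀) : ℂ) * S (max y x₀))

/-- The combination of WKB waves that extends `u = S^> v^<` to the left of `x₀`. -/
def wkbSol (α θ x₀ : ℝ) (S : ℝ → ℂ) (x : ℝ) : ℂ :=
  (amp α θ x : ℂ) * (Complex.exp (-Complex.I * phase α θ x) * coeffPlus α θ x₀ S x +
    Complex.exp (Complex.I * phase α θ x) * coeffMinus α θ x₀ S x)

/-- The derivative of `wkbSol`. -/
def wkbSolDeriv (α θ x₀ : ℝ) (S : ℝ → ℂ) (x : ℝ) : ℂ :=
  ampDeriv α θ x * (Complex.exp (-Complex.I * phase α θ x) * coeffPlus α θ x₀ S x +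
    Complex.exp (Complex.I * phase α θ x) * coeffMinus α θ x₀ S x) +
  Complex.I * (amp α θ x : ℂ)⁻¹ *
    (Complex.exp (Complex.I * phase α θ x) * coeffMinus α θ x₀ S x -
      Complex.exp (-Complex.I * phase α θ x) * coeffPlus α θ x₀ S x)

section Volterra

variable {α θ x₀ : ℝ} {S : ℝ → ℂ}

lemma continuous_Mfun_mul_max (hα : 0 < α) (hθ : 0 < θ) (hx₀ : 0 < x₀)
    (hS : ContinuousOn S (Ici x₀)) :
    Continuous fun y => (Mfun α θ (max y x₀) : ℂ) * S (max y x₀) := by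
  have hm : Continuous fun y : ℝ => max y x₀ := by fun_prop
  exact (Complex.continuous_ofReal.comp ((continuousOn_Mfun hα hθ).comp_continuous hm
    fun y => hx₀.trans_le (le_max_right y x₀))).mul
      (hS.comp_continuous hm fun y => le_max_right y x₀)

lemma hasDerivAt_coeffPlus (hα : 0 < α) (hθ : 0 < θ) (hx₀ : 0 < x₀)
    (hS : ContinuousOn S (Ici x₀)) (x : ℝ) :
    HasDerivAt (coeffPlus α θ x₀ S) ((2 * Complex.I)⁻¹ *
      ((Mfun α θ (max x x₀) : ℂ) * S (max x x₀) *
        Complex.exp (2 * Complex.I * phase α θ x))) x := by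
  have hφ : Continuous (phase α θ) :=
    continuous_iff_continuousAt.2 fun y => (hasDerivAt_phase hα hθ y).continuousAt
  have hc := (continuous_Mfun_mul_max hα hθ hx₀ hS).mul
    (by fun_prop : Continuous fun y => Complex.exp (2 * Complex.I * phase α θ y))
  exact ((hc.integral_hasStrictDerivAt x₀ x).hasDerivAt.const_mul _).const_add 1

lemma hasDerivAt_coeffMinus (hα : 0 < α) (hθ : 0 < θ) (hx₀ : 0 < x₀)
    (hS : ContinuousOn S (Ici x₀)) (x : ℝ) :
    HasDerivAt (coeffMinus α θ x₀ S) ((2 * Complex.I)⁻¹ *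
      -((Mfun α θ (max x x₀) : ℂ) * S (max x x₀))) x :=
  (((continuous_Mfun_mul_max hα hθ hx₀ hS).integral_hasStrictDerivAt x₀ x).hasDerivAt.const_sub
    _).const_mul _

lemma IsVolterraSol.mul_exp_eq (hα : 0 < α) (hθ : 0 < θ) (hx₀ : 0 < x₀)
    (hS : IsVolterraSol α θ x₀ S) {x : ℝ} (hx : x₀ ≤ x) :
    S x * Complex.exp (Complex.I * phase α θ x) =
      Complex.exp (-Complex.I * phase α θ x) * coeffPlus α θ x₀ S x +
        Complex.exp (Complex.I * phase α θ x) * coeffMinus α θ x₀ S x := by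
  obtain ⟨hb, hc, he⟩ := hS
  have hE : Complex.exp (-2 * Complex.I * phase α θ x) * Complex.exp (Complex.I * phase α θ x) =
      Complex.exp (-Complex.I * phase α θ x) := by
    rw [← Complex.exp_add]
    ring_nf
  rw [he x hx, Kop_zero_eq (integrableOn_Mfun_mul hα hθ hx₀ hb hc) hx, coeffPlus, coeffMinus, ← hE]
  ring

lemma IsVolterraSol.mul_vminus_eq (hα : 0 < α) (hθ : 0 < θ) (hx₀ : 0 < x₀)
    (hS : IsVolterraSol α θ x₀ S) {x : ℝ} (hx : x₀ ≤ x) :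
    S x * vminus α θ x = wkbSol α θ x₀ S x := by
  rw [wkbSol, ← hS.mul_exp_eq hα hθ hx₀ hx, vminus]
  ring

lemma exp_mul_coeff_derivs (x : ℝ) (m : ℂ) :
    Complex.exp (-Complex.I * phase α θ x) *
        ((2 * Complex.I)⁻¹ * (m * Complex.exp (2 * Complex.I * phase α θ x))) =
      (2 * Complex.I)⁻¹ * (m * Complex.exp (Complex.I * phase α θ x)) := by
  have hE : Complex.exp (-Complex.I * phase α θ x) * Complex.exp (2 * Complex.I * phase α θ x) =
      Complex.exp (Complex.I * phase α θ x) := by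
    rw [← Complex.exp_add]
    ring_nf
  rw [← hE]
  ring

lemma hasDerivAt_wkbSol (hα : 0 < α) (hθ : 0 < θ) (hx₀ : 0 < x₀)
    (hS : ContinuousOn S (Ici x₀)) {x : ℝ} (hx : 0 < x) :
    HasDerivAt (wkbSol α θ x₀ S) (wkbSolDeriv α θ x₀ S x) x := by
  refine hasDerivAt_wkb_comb hα hθ hx (hasDerivAt_coeffPlus hα hθ hx₀ hS x)
    (hasDerivAt_coeffMinus hα hθ hx₀ hS x) ?_
  rw [exp_mul_coeff_derivs]
  ring

lemma IsVolterraSol.hasDerivAt_wkbSolDeriv (hα : 0 < α) (hθ : 0 < θ) (hx₀ : 0 < x₀)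
    (hS : IsVolterraSol α θ x₀ S) {x : ℝ} (hx : x₀ ≤ x) :
    HasDerivAt (wkbSolDeriv α θ x₀ S) (-((spd α θ x : ℂ)⁻¹ ^ 2 * wkbSol α θ x₀ S x)) x := by
  refine hasDerivAt_wkb_comb_deriv hα hθ (hx₀.trans_le hx)
    (hasDerivAt_coeffPlus hα hθ hx₀ hS.2.1 x) (hasDerivAt_coeffMinus hα hθ hx₀ hS.2.1 x) ?_ ?_
  · rw [exp_mul_coeff_derivs]
    ring
  · rw [exp_mul_coeff_derivs, ← hS.mul_exp_eq hα hθ hx₀ hx, max_eq_left hx, mul_inv,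
      Complex.inv_I]
    ring

lemma IsVolterraSol.hasDerivWithinAt (hα : 0 < α) (hθ : 0 < θ) (hx₀ : 0 < x₀)
    (hS : IsVolterraSol α θ x₀ S) {x : ℝ} (hx : x₀ ≤ x) :
    HasDerivWithinAt (fun y => S y * vminus α θ y) (wkbSolDeriv α θ x₀ S x) (Ici x₀) x :=
  (hasDerivAt_wkbSol hα hθ hx₀ hS.2.1 (hx₀.trans_le hx)).hasDerivWithinAt.congr
    (fun _ hy => hS.mul_vminus_eq hα hθ hx₀ hy) (hS.mul_vminus_eq hα hθ hx₀ hx)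

lemma IsVolterraSol.derivWithin_eq (hα : 0 < α) (hθ : 0 < θ) (hx₀ : 0 < x₀)
    (hS : IsVolterraSol α θ x₀ S) {x : ℝ} (hx : x₀ ≤ x) :
    derivWithin (fun y => S y * vminus α θ y) (Ici x₀) x = wkbSolDeriv α θ x₀ S x :=
  (hS.hasDerivWithinAt hα hθ hx₀ hx).derivWithin (uniqueDiffOn_Ici x₀ x hx)

lemma IsVolterraSol.contDiffOn_wkbSol (hα : 0 < α) (hθ : 0 < θ) (hx₀ : 0 < x₀)
    (hS : IsVolterraSol α θ x₀ S) : ContDiffOn ℝ 2 (wkbSol α θ x₀ S) (Ioi x₀) := by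
  have hd : ∀ x ∈ Ioi x₀, HasDerivAt (wkbSol α θ x₀ S) (wkbSolDeriv α θ x₀ S x) x :=
    fun x hx => hasDerivAt_wkbSol hα hθ hx₀ hS.2.1 (hx₀.trans hx)
  have hd₂ : ∀ x ∈ Ioi x₀, HasDerivAt (wkbSolDeriv α θ x₀ S)
      (-((spd α θ x : ℂ)⁻¹ ^ 2 * wkbSol α θ x₀ S x)) x :=
    fun x hx => hS.hasDerivAt_wkbSolDeriv hα hθ hx₀ (mem_Ioi.1 hx).le
  have hs : Continuous fun x => (spd α θ x : ℂ)⁻¹ :=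
    (Complex.continuous_ofReal.comp (continuous_spd hα hθ)).inv₀ fun x =>
      Complex.ofReal_ne_zero.2 (spd_pos α hθ x).ne'
  have hc : ContinuousOn (wkbSol α θ x₀ S) (Ioi x₀) :=
    fun x hx => (hd x hx).continuousAt.continuousWithinAt
  rw [show (2 : WithTop ℕ∞) = 1 + 1 by norm_num, contDiffOn_succ_iff_deriv_of_isOpen isOpen_Ioi]
  refine ⟨fun x hx => (hd x hx).differentiableAt.differentiableWithinAt, by simp, ?_⟩
  refine ContDiffOn.congr (f := wkbSolDeriv α θ x₀ S) ?_ fun x hx => (hd x hx).deriv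
  rw [show (1 : WithTop ℕ∞) = 0 + 1 by norm_num, contDiffOn_succ_iff_deriv_of_isOpen isOpen_Ioi]
  refine ⟨fun x hx => (hd₂ x hx).differentiableAt.differentiableWithinAt, by simp, ?_⟩
  rw [contDiffOn_zero]
  exact ((hs.pow 2).continuousOn.mul hc).neg.congr fun x hx => (hd₂ x hx).deriv

end Volterra

lemma coeffPlus_self (α θ x₀ : ℝ) (S : ℝ → ℂ) : coeffPlus α θ x₀ S x₀ = 1 := by
  simp [coeffPlus]

lemma coeffMinus_self (α θ x₀ : ℝ) (S : ℝ → ℂ) : coeffMinus α θ x₀ S x₀ = Rx α θ x₀ S := by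
  simp [coeffMinus, Rx]

/-- `u = S^> v^<` is a nonzero solution with explicit data at `x₀`. -/
theorem stmt5 (α θ x₀ : ℝ) (hα : 0 < α) (hθ : 0 < θ) (hx₀ : 0 < x₀)
    (hM : Mtail α θ x₀ < 2) (S : ℝ → ℂ) (hS : IsVolterraSol α θ x₀ S) :
    ContDiffOn ℝ 2 (fun x => S x * vminus α θ x) (Ioi x₀) ∧
    (∀ x ∈ Ici x₀,
      derivWithin (derivWithin (fun y => S y * vminus α θ y) (Ici x₀)) (Ici x₀) x +
          ((spd α θ x : ℂ))⁻¹ ^ 2 * (S x * vminus α θ x) = 0) ∧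
    ¬(S x₀ * vminus α θ x₀ = 0 ∧
        derivWithin (fun y => S y * vminus α θ y) (Ici x₀) x₀ = 0) ∧
    S x₀ * vminus α θ x₀ =
      (amp α θ x₀ : ℂ) *
        (Complex.exp (-Complex.I * (phase α θ x₀ : ℂ)) +
          Rx α θ x₀ S * Complex.exp (Complex.I * (phase α θ x₀ : ℂ))) ∧
    derivWithin (fun y => S y * vminus α θ y) (Ici x₀) x₀ =
      ((deriv (fun y => amp α θ y) x₀ : ℂ) / (amp α θ x₀ : ℂ)) * (S x₀ * vminus α θ x₀) +
        Complex.I * ((spd α θ x₀ : ℂ))⁻¹ * (amp α θ x₀ : ℂ) *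
          (Rx α θ x₀ S * Complex.exp (Complex.I * (phase α θ x₀ : ℂ)) -
            Complex.exp (-Complex.I * (phase α θ x₀ : ℂ))) := by
  have ha : (amp α θ x₀ : ℂ) ≠ 0 := Complex.ofReal_ne_zero.2 (amp_pos α hθ x₀).ne'
  have hu : S x₀ * vminus α θ x₀ = (amp α θ x₀ : ℂ) *
      (Complex.exp (-Complex.I * (phase α θ x₀ : ℂ)) +
        Rx α θ x₀ S * Complex.exp (Complex.I * (phase α θ x₀ : ℂ))) := by
    rw [hS.mul_vminus_eq hα hθ hx₀ le_rfl, wkbSol, coeffPlus_self, coeffMinus_self, mul_one,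
      mul_comm (Rx α θ x₀ S)]
  have hu' : derivWithin (fun y => S y * vminus α θ y) (Ici x₀) x₀ =
      ((deriv (fun y => amp α θ y) x₀ : ℂ) / (amp α θ x₀ : ℂ)) * (S x₀ * vminus α θ x₀) +
        Complex.I * ((spd α θ x₀ : ℂ))⁻¹ * (amp α θ x₀ : ℂ) *
          (Rx α θ x₀ S * Complex.exp (Complex.I * (phase α θ x₀ : ℂ)) -
            Complex.exp (-Complex.I * (phase α θ x₀ : ℂ))) := by
    rw [hS.derivWithin_eq hα hθ hx₀ le_rfl, wkbSolDeriv, coeffPlus_self, coeffMinus_self, hu,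
      (hasDerivAt_amp α hθ hx₀).ofReal_comp.deriv, ← amp_mul_self α hθ x₀]
    push_cast
    field_simp
  refine ⟨(hS.contDiffOn_wkbSol hα hθ hx₀).congr fun x hx =>
    hS.mul_vminus_eq hα hθ hx₀ (mem_Ioi.1 hx).le, fun x hx => ?_, ?_, hu, hu'⟩
  · have h : HasDerivWithinAt (derivWithin (fun y => S y * vminus α θ y) (Ici x₀))
        (-((spd α θ x : ℂ)⁻¹ ^ 2 * wkbSol α θ x₀ S x)) (Ici x₀) x :=
      (hS.hasDerivAt_wkbSolDeriv hα hθ hx₀ hx).hasDerivWithinAt.congr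
        (fun y hy => hS.derivWithin_eq hα hθ hx₀ hy) (hS.derivWithin_eq hα hθ hx₀ hx)
    rw [h.derivWithin (uniqueDiffOn_Ici x₀ x hx), hS.mul_vminus_eq hα hθ hx₀ hx, neg_add_cancel]
  · rintro ⟨h₀, h₁⟩
    have hs : (spd α θ x₀ : ℂ)⁻¹ ≠ 0 :=
      inv_ne_zero (Complex.ofReal_ne_zero.2 (spd_pos α hθ x₀).ne')
    rw [hu', h₀, mul_zero, zero_add] at h₁
    have hm := (mul_eq_zero.1 h₁).resolve_left (mul_ne_zero (mul_ne_zero Complex.I_ne_zero hs) ha)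
    have hp := (mul_eq_zero.1 (hu.symm.trans h₀)).resolve_left ha
    refine Complex.exp_ne_zero (-Complex.I * (phase α θ x₀ : ℂ)) ?_
    linear_combination (hp - hm) / 2
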